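/- (Borwein–Preiss smooth variational principle, Corollary 3.3.) Let (X, ‖·‖) be a real Banach space whose norm is Fréchet differentiable at every nonzero point, and let f : X → ℝ ∪ {+∞} be proper, lower semicontinuous and bounded below. Let Y = {g : X → ℝ : g is continuously Fréchet differentiable, convex, g ≥ 0, g(x) → +∞ as ‖x‖ → +∞, and Σ_{n≥1} ‖g‖ₙ/2ⁿ + sup_{‖x‖≤1} ‖g′(x)‖_{X*} < ∞}, equipped with the metric ρ_Y(g,h) = Σ_{n≥1} ‖g − h‖ₙ/2ⁿ + sup_{‖x‖≤1} ‖(g − h)′(x)‖_{X*}. Then the set {g ∈ Y : f + g attains a strong minimum on X} is residual (comeagre) in (Y, ρ_Y). -/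

import Mathlib

open Filter Set ENNReal

/-- `‖f‖_r = sup {|f x| : ‖x‖ ≤ r}`, valued in `ℝ≥0∞`. -/
noncomputable def ballSup {X : Type*} [NormedAddCommGroup X] (f : X → ℝ) (r : ℝ) : ℝ≥0∞ :=
  ⨆ x ∈ {x : X | ‖x‖ ≤ r}, (‖f x‖₊ : ℝ≥0∞)

/-- `μ(f) = Σ_{n ≥ 1} ‖f‖ₙ / 2ⁿ`, valued in `ℝ≥0∞`. -/
noncomputable def mu {X : Type*} [NormedAddCommGroup X] (f : X → ℝ) : ℝ≥0∞ :=
  ∑' n : ℕ, ballSup f (n + 1) / 2 ^ (n + 1)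

/-- The norm `μ_Y (g) = Σ_{n ≥ 1} ‖g‖ₙ/2ⁿ + sup_{‖x‖ ≤ 1} ‖g'(x)‖`, valued in `ℝ≥0∞`. -/
noncomputable def muBP {X : Type*} [NormedAddCommGroup X] [NormedSpace ℝ X]
    (g : X → ℝ) : ℝ≥0∞ :=
  mu g + ⨆ x ∈ {x : X | ‖x‖ ≤ 1}, (‖fderiv ℝ g x‖₊ : ℝ≥0∞)

/-- `h : X → ℝ ∪ {+∞}` attains a strong minimum at `x₀` if `h x₀ = inf h` and every
minimizing sequence for `h` converges in norm to `x₀`. -/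
def AttainsStrongMin {X : Type*} [NormedAddCommGroup X] (h : X → EReal) (x₀ : X) : Prop :=
  h x₀ = ⨅ x, h x ∧
  ∀ u : ℕ → X, Tendsto (fun j => h (u j)) atTop (nhds (⨅ x, h x)) →
    Tendsto u atTop (nhds x₀)

section Convex

variable {X : Type*} [NormedAddCommGroup X] [NormedSpace ℝ X]

/-- A convex function lies above its tangents. -/
theorem ConvexOn.fderiv_apply_le_sub {p : X → ℝ} (hp : ConvexOn ℝ univ p) {y : X}
    (hd : DifferentiableAt ℝ p y) (v : X) : fderiv ℝ p y v ≤ p (y + v) - p y := by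
  have hl : HasDerivAt (fun t : ℝ => y + t • v) v 0 := by
    simpa using ((hasDerivAt_id (0 : ℝ)).smul_const v).const_add y
  have hd' : HasFDerivAt p (fderiv ℝ p y) (y + (0 : ℝ) • v) := by simpa using hd.hasFDerivAt
  have hcomp : HasDerivAt (fun t : ℝ => p (y + t • v)) (fderiv ℝ p y v) 0 :=
    hd'.comp_hasDerivAt (0 : ℝ) hl
  have hconv : ConvexOn ℝ univ (fun t : ℝ => p (y + t • v)) := by
    refine ⟨convex_univ, fun s _ t _ a b ha hb hab => ?_⟩
    have key := hp.2 (mem_univ (y + s • v)) (mem_univ (y + t • v)) ha hb hab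
    have e : a • (y + s • v) + b • (y + t • v) = y + (a • s + b • t) • v := by
      rw [← sub_eq_zero]
      have : y = (a + b) • y := by rw [hab, one_smul]
      nth_rewrite 3 [this]
      simp only [smul_eq_mul]
      module
    rwa [e] at key
  have := hconv.le_slope_of_hasDerivAt (mem_univ 0) (mem_univ 1) one_pos hcomp
  simpa [slope_def_field] using this

/-- A differentiable convex function is continuously differentiable. -/
theorem ConvexOn.contDiff_one {p : X → ℝ} (hp : ConvexOn ℝ univ p)
    (hd : Differentiable ℝ p) : ContDiff ℝ 1 p := by
  rw [contDiff_one_iff_fderiv]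
  refine ⟨hd, continuous_iff_continuousAt.2 fun x => Metric.continuousAt_iff.2 fun ε hε => ?_⟩
  have hε4 : 0 < ε / 4 := by positivity
  have ho := (hasFDerivAt_iff_isLittleO_nhds_zero.1 (hd x).hasFDerivAt).def hε4
  obtain ⟨δ, hδ, hball⟩ := Metric.eventually_nhds_iff.1 ho
  refine ⟨δ / 3, by positivity, fun {y} hy => ?_⟩
  rw [dist_eq_norm] at hy ⊢
  have hscale : ∀ v : X, ‖v‖ = δ / 3 →
      (fderiv ℝ p y - fderiv ℝ p x) v ≤ ε / 2 * ‖v‖ := by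
    intro v hv
    have hlt : ‖y - x + v‖ ≤ ‖y - x‖ + ‖v‖ := norm_add_le _ _
    have hup := hball (y := y - x + v) (by rw [dist_zero_right]; linarith)
    have hy1 := hp.fderiv_apply_le_sub (hd y) v
    have hx1 := hp.fderiv_apply_le_sub (hd x) (y - x)
    have e1 : x + (y - x + v) = y + v := by abel
    have e2 : x + (y - x) = y := by abel
    rw [e1, Real.norm_eq_abs] at hup
    rw [e2] at hx1
    have hup' := (le_abs_self _).trans hup
    rw [map_add] at hup'
    rw [sub_apply]
    nlinarith
  have hbound : ∀ v : X, (fderiv ℝ p y - fderiv ℝ p x) v ≤ ε / 2 * ‖v‖ := by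
    intro v
    rcases eq_or_ne v 0 with rfl | hv
    · simp
    have hv' : 0 < ‖v‖ := norm_pos_iff.2 hv
    have hs : 0 < δ / 3 / ‖v‖ := by positivity
    have hn : ‖(δ / 3 / ‖v‖) • v‖ = δ / 3 / ‖v‖ * ‖v‖ := by
      rw [norm_smul, Real.norm_of_nonneg hs.le]
    have key := hscale ((δ / 3 / ‖v‖) • v) (by rw [hn]; field_simp)
    rw [hn, map_smul, smul_eq_mul] at key
    have : δ / 3 / ‖v‖ * ((fderiv ℝ p y - fderiv ℝ p x) v) ≤ δ / 3 / ‖v‖ * (ε / 2 * ‖v‖) := by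
      linarith
    exact le_of_mul_le_mul_left this hs
  refine lt_of_le_of_lt
    (ContinuousLinearMap.opNorm_le_bound _ (by positivity) fun v => ?_) (half_lt_self hε)
  rw [Real.norm_eq_abs, abs_le]
  refine ⟨?_, hbound v⟩
  have := hbound (-v)
  rw [map_neg, norm_neg] at this
  linarith

/-- Beyond a sphere on which a convex function dominates its value at the centre, the function
dominates its lower bound on that sphere. -/
theorem ConvexOn.le_of_le_on_sphere {h : X → ℝ} (hh : ConvexOn ℝ univ h) {R c : ℝ} (hR : 0 < R)
    (h0 : h 0 ≤ c) (hs : ∀ y, ‖y‖ = R → c ≤ h y) {x : X} (hx : R ≤ ‖x‖) : c ≤ h x := by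
  have hx0 : 0 < ‖x‖ := hR.trans_le hx
  have ht : 0 < R / ‖x‖ := by positivity
  have ht1 : R / ‖x‖ ≤ 1 := (div_le_one hx0).2 hx
  have hy := hs ((R / ‖x‖) • x) (by
    rw [norm_smul, Real.norm_of_nonneg ht.le]; field_simp)
  have key := hh.2 (mem_univ (0 : X)) (mem_univ x) (sub_nonneg.2 ht1) ht.le (by ring)
  rw [smul_zero, zero_add, smul_eq_mul, smul_eq_mul] at key
  by_contra! hlt
  nlinarith

end Convex

section NormSq

variable {X : Type*} [NormedAddCommGroup X] [NormedSpace ℝ X]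

theorem convexOn_norm_sub_sq (a : X) : ConvexOn ℝ univ (fun x : X => ‖x - a‖ ^ 2) := by
  have h : ConvexOn ℝ univ (fun x : X => ‖x - a‖) := by
    simpa [dist_eq_norm] using convexOn_univ_dist a
  exact h.pow (fun _ _ => norm_nonneg _) 2

theorem differentiable_norm_sub_sq
    (hsmooth : ∀ x : X, x ≠ 0 → DifferentiableAt ℝ (fun y : X => ‖y‖) x) (a : X) :
    Differentiable ℝ (fun x : X => ‖x - a‖ ^ 2) := by
  intro x
  have key : DifferentiableAt ℝ (fun y : X => ‖y‖ ^ 2) (x - a) := by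
    rcases eq_or_ne (x - a) 0 with h | h
    · rw [h]
      refine HasFDerivAt.differentiableAt (f' := 0) (hasFDerivAt_iff_isLittleO_nhds_zero.2 ?_)
      simpa using Asymptotics.isLittleO_norm_pow_id (E' := X) one_lt_two
    · exact (hsmooth _ h).pow 2
  exact key.comp x (differentiableAt_id.sub_const a)

theorem norm_fderiv_norm_sub_sq_le (l : ℝ) (a x : X) :
    ‖fderiv ℝ (fun x : X => l * ‖x - a‖ ^ 2) x‖ ≤ |l| * (2 * ‖x - a‖ + 1) := by
  refine norm_fderiv_le_of_lip' ℝ (by positivity) ?_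
  filter_upwards [Metric.ball_mem_nhds x one_pos] with y hy
  rw [Metric.mem_ball, dist_eq_norm] at hy
  have h1 : |‖y - a‖ - ‖x - a‖| ≤ ‖y - x‖ := by
    simpa using abs_norm_sub_norm_le (y - a) (x - a)
  have h2 : ‖y - a‖ + ‖x - a‖ ≤ 2 * ‖x - a‖ + 1 := by
    linarith [(abs_le.1 h1).2]
  have e : l * ‖y - a‖ ^ 2 - l * ‖x - a‖ ^ 2 =
      l * ((‖y - a‖ + ‖x - a‖) * (‖y - a‖ - ‖x - a‖)) := by ring
  rw [e, Real.norm_eq_abs, abs_mul, abs_mul, mul_assoc,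
    abs_of_nonneg (by positivity : 0 ≤ ‖y - a‖ + ‖x - a‖)]
  gcongr

end NormSq

section Seminorm

variable {X : Type*} [NormedAddCommGroup X]

theorem ballSup_le_ofReal {g : X → ℝ} {r c : ℝ} (h : ∀ x, ‖x‖ ≤ r → |g x| ≤ c) :
    ballSup g r ≤ ENNReal.ofReal c := by
  refine iSup₂_le fun x hx => ?_
  rw [← enorm_eq_nnnorm, ← ofReal_norm]
  exact ENNReal.ofReal_le_ofReal (h x hx)

theorem ballSup_add_le (g h : X → ℝ) (r : ℝ) : ballSup (g + h) r ≤ ballSup g r + ballSup h r := by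
  refine iSup₂_le fun x hx => ?_
  calc (‖(g + h) x‖₊ : ℝ≥0∞) ≤ ‖g x‖₊ + ‖h x‖₊ := by exact_mod_cast nnnorm_add_le _ _
    _ ≤ _ := add_le_add (le_iSup₂ (f := fun x (_ : x ∈ {x : X | ‖x‖ ≤ r}) => (‖g x‖₊ : ℝ≥0∞)) x hx)
      (le_iSup₂ (f := fun x (_ : x ∈ {x : X | ‖x‖ ≤ r}) => (‖h x‖₊ : ℝ≥0∞)) x hx)

theorem mu_add_le (g h : X → ℝ) : mu (g + h) ≤ mu g + mu h := by
  unfold mu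
  rw [← ENNReal.tsum_add]
  refine ENNReal.tsum_le_tsum fun n => ?_
  rw [← ENNReal.add_div]
  gcongr
  exact ballSup_add_le _ _ _

variable [NormedSpace ℝ X]

theorem muBP_add_le {g h : X → ℝ} (hg : Differentiable ℝ g) (hh : Differentiable ℝ h) :
    muBP (g + h) ≤ muBP g + muBP h := by
  unfold muBP
  rw [add_add_add_comm]
  refine add_le_add (mu_add_le g h) (iSup₂_le fun x hx => ?_)
  rw [fderiv_add (hg x) (hh x)]
  calc (‖fderiv ℝ g x + fderiv ℝ h x‖₊ : ℝ≥0∞) ≤ ‖fderiv ℝ g x‖₊ + ‖fderiv ℝ h x‖₊ := by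
        exact_mod_cast nnnorm_add_le _ _
    _ ≤ _ := add_le_add
      (le_iSup₂ (f := fun x (_ : x ∈ {x : X | ‖x‖ ≤ 1}) => (‖fderiv ℝ g x‖₊ : ℝ≥0∞)) x hx)
      (le_iSup₂ (f := fun x (_ : x ∈ {x : X | ‖x‖ ≤ 1}) => (‖fderiv ℝ h x‖₊ : ℝ≥0∞)) x hx)

theorem abs_lt_of_muBP_lt {g : X → ℝ} {η : ℝ} {N : ℕ}
    (hg : muBP g < ENNReal.ofReal (η / 2 ^ (N + 1))) {x : X} (hx : ‖x‖ ≤ N + 1) : |g x| < η := by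
  have h1 : (‖g x‖₊ : ℝ≥0∞) / 2 ^ (N + 1) < ENNReal.ofReal (η / 2 ^ (N + 1)) := by
    refine lt_of_le_of_lt ?_ hg
    calc (‖g x‖₊ : ℝ≥0∞) / 2 ^ (N + 1) ≤ ballSup g (N + 1) / 2 ^ (N + 1) := by
          gcongr
          exact le_iSup₂ (f := fun x (_ : x ∈ {x : X | ‖x‖ ≤ (N : ℝ) + 1}) =>
            (‖g x‖₊ : ℝ≥0∞)) x hx
      _ ≤ mu g := ENNReal.le_tsum (f := fun n : ℕ => ballSup g (n + 1) / 2 ^ (n + 1)) N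
      _ ≤ muBP g := le_self_add
  have h2 : (‖g x‖₊ : ℝ≥0∞) / 2 ^ (N + 1) = ENNReal.ofReal (|g x| / 2 ^ (N + 1)) := by
    rw [ENNReal.ofReal_div_of_pos (by positivity), ENNReal.ofReal_pow (by norm_num),
      ← Real.norm_eq_abs, ofReal_norm, enorm_eq_nnnorm]
    norm_num
  rw [h2] at h1
  have h3 := (ENNReal.ofReal_lt_ofReal_iff_of_nonneg (by positivity)).1 h1
  exact (div_lt_div_iff_of_pos_right (by positivity)).1 h3

/-- The translated squared norms, with centres in a bounded set, are uniformly `muBP`-bounded. -/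
theorem exists_muBP_norm_sub_sq_le (R : ℝ) : ∃ K : ℝ, 0 < K ∧ ∀ (l : ℝ) (a : X), ‖a‖ ≤ R →
    muBP (fun x : X => l * ‖x - a‖ ^ 2) ≤ ENNReal.ofReal (|l| * K) := by
  have hsum : Summable fun n : ℕ => ((n : ℝ) + 1 + |R|) ^ 2 / 2 ^ (n + 1) := by
    have h0 : Summable fun n : ℕ => (n : ℝ) ^ 2 * (1 / 2 : ℝ) ^ n :=
      summable_pow_mul_geometric_of_norm_lt_one 2 (by norm_num)
    have h1 := ((summable_nat_add_iff 1).2 h0).mul_left ((1 + |R|) ^ 2)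
    refine Summable.of_nonneg_of_le (fun n => by positivity) (fun n => ?_) h1
    have : ((n : ℝ) + 1 + |R|) ^ 2 ≤ ((1 + |R|) * (n + 1)) ^ 2 := by
      gcongr
      nlinarith [abs_nonneg R, (Nat.cast_nonneg n : (0 : ℝ) ≤ n)]
    calc ((n : ℝ) + 1 + |R|) ^ 2 / 2 ^ (n + 1) ≤ ((1 + |R|) * (n + 1)) ^ 2 / 2 ^ (n + 1) := by
          gcongr
      _ = _ := by push_cast; rw [one_div, inv_pow]; ring
  set S := ∑' n : ℕ, ((n : ℝ) + 1 + |R|) ^ 2 / 2 ^ (n + 1) with hS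
  have hS0 : 0 ≤ S := tsum_nonneg fun n => by positivity
  refine ⟨S + (2 * (1 + |R|) + 1), by positivity, fun l a ha => ?_⟩
  have hxa : ∀ {x : X} {r : ℝ}, ‖x‖ ≤ r → ‖x - a‖ ≤ r + |R| := fun {x r} hx =>
    (norm_sub_le x a).trans (add_le_add hx (ha.trans (le_abs_self R)))
  rw [mul_add, ENNReal.ofReal_add (by positivity) (by positivity)]
  refine add_le_add ?_ (iSup₂_le fun x hx => ?_)
  · rw [hS, ← tsum_mul_left, ENNReal.ofReal_tsum_of_nonneg (fun n => by positivity)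
      (hsum.mul_left _)]
    refine ENNReal.tsum_le_tsum fun n => ?_
    rw [← mul_div_assoc, ENNReal.ofReal_div_of_pos (by positivity),
      ENNReal.ofReal_pow (by norm_num), ENNReal.ofReal_ofNat]
    gcongr
    refine ballSup_le_ofReal fun x hx => ?_
    rw [abs_mul, abs_of_nonneg (sq_nonneg ‖x - a‖)]
    gcongr
    exact hxa hx
  · rw [← enorm_eq_nnnorm, ← ofReal_norm]
    refine ENNReal.ofReal_le_ofReal ((norm_fderiv_norm_sub_sq_le l a x).trans ?_)
    gcongr
    exact hxa hx

end Seminorm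

section StrongMin

/-- A proper extended real function bounded below has a real greatest lower bound. -/
theorem exists_real_isGLB {ι : Type*} {h : ι → EReal} {b : ℝ} (hb : ∀ x, (b : EReal) ≤ h x)
    (hp : ∃ x, h x ≠ ⊤) : ∃ m : ℝ, (∀ x, (m : EReal) ≤ h x) ∧
      ∀ d : ℝ, 0 < d → ∃ x, h x < ((m + d : ℝ) : EReal) := by
  obtain ⟨x, hx⟩ := hp
  have h1 : (⨅ x, h x) ≠ ⊤ := ((iInf_le h x).trans_lt hx.lt_top).ne
  have h2 : (⨅ x, h x) ≠ ⊥ := ((EReal.bot_lt_coe b).trans_le (le_iInf hb)).ne'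
  have e : (((⨅ x, h x).toReal : ℝ) : EReal) = ⨅ x, h x := EReal.coe_toReal h1 h2
  refine ⟨(⨅ x, h x).toReal, fun x => e ▸ iInf_le h x, fun d hd => iInf_lt_iff.1 ?_⟩
  rw [← e]
  exact_mod_cast lt_add_of_pos_right _ hd

variable {X : Type*} [NormedAddCommGroup X]

/-- A lower semicontinuous function on a complete space all of whose low sublevel sets can be
enclosed in arbitrarily small balls attains a strong minimum. -/
theorem exists_attainsStrongMin [CompleteSpace X] {h : X → EReal} (hlsc : LowerSemicontinuous h)
    (hloc : ∀ n : ℕ, ∃ (a : X) (c : EReal), h a < c ∧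
      ∀ x, 1 / ((n : ℝ) + 1) ≤ ‖x - a‖ → c ≤ h x) :
    ∃ x₀, AttainsStrongMin h x₀ := by
  set m := ⨅ x, h x with hm
  have hne : (comap h (nhds m)).NeBot := by
    rw [comap_neBot_iff]
    intro t ht
    have hcl : m ∈ closure (range h) := by
      rw [hm, ← sInf_range]
      exact sInf_mem_closure (range_nonempty_iff_nonempty.2 ⟨0⟩)
    obtain ⟨_, hy, x, rfl⟩ := mem_closure_iff_nhds.1 hcl t ht
    exact ⟨x, hy⟩
  have hcauchy : Cauchy (comap h (nhds m)) := by
    rw [Metric.cauchy_iff]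
    refine ⟨hne, fun ε hε => ?_⟩
    obtain ⟨n, hn⟩ := exists_nat_one_div_lt (half_pos hε)
    obtain ⟨a, c, hac, hc⟩ := hloc n
    have hmc : m < c := (iInf_le h a).trans_lt hac
    refine ⟨h ⁻¹' Iio c, preimage_mem_comap (Iio_mem_nhds hmc), fun x hx y hy => ?_⟩
    have hball : ∀ z, h z < c → dist z a < ε / 2 := fun z hz => by
      rw [dist_eq_norm]
      by_contra! hge
      exact absurd hz (not_lt.2 (hc z (hn.le.trans hge)))
    linarith [dist_triangle_right x y a, hball x hx, hball y hy]
  obtain ⟨x₀, hx₀⟩ := CompleteSpace.complete hcauchy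
  refine ⟨x₀, le_antisymm (le_of_not_gt fun hlt => ?_) (iInf_le h x₀), fun u hu => ?_⟩
  · obtain ⟨y, hmy, hy⟩ := exists_between hlt
    have hbelow : ∀ᶠ x in comap h (nhds m), h x < y :=
      preimage_mem_comap (Iio_mem_nhds hmy)
    obtain ⟨x, hxy, hyx⟩ := (hbelow.and (hx₀ (hlsc x₀ y hy))).exists
    exact lt_asymm hxy hyx
  · exact (tendsto_comap_iff.2 hu).mono_right hx₀

end StrongMin

/-- The Borwein–Preiss smooth variational principle (Corollary 3.3): in a Banach space with
a Fréchet smooth norm, for every proper lower semicontinuous bounded below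
`f : X → ℝ ∪ {+∞}` the set `{g ∈ Y : f + g attains a strong minimum on X}` is residual in
`(Y, ρ_Y)`, where `Y` is the space of nonnegative convex `C¹` functions tending to `+∞`
at infinity with finite norm `μ_Y`, and `ρ_Y (g, h) = μ_Y (g - h)`. -/
theorem borwein_preiss_variational_principle
    {X : Type*} [NormedAddCommGroup X] [NormedSpace ℝ X] [CompleteSpace X]
    (hsmooth : ∀ x : X, x ≠ 0 → DifferentiableAt ℝ (fun y : X => ‖y‖) x)
    (f : X → EReal)
    (hbot : ∀ x, f x ≠ ⊥) (hproper : ∃ x, f x ≠ ⊤)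
    (hlsc : LowerSemicontinuous f) (hbdd : ∃ b : ℝ, ∀ x, (b : EReal) ≤ f x)
    (Y : Set (X → ℝ))
    (hY : Y = {g : X → ℝ | ContDiff ℝ 1 g ∧ ConvexOn ℝ univ g ∧ (∀ x, 0 ≤ g x) ∧
      Tendsto g (comap (fun x : X => ‖x‖) atTop) atTop ∧ muBP g < ⊤}) :
    ∃ U : ℕ → Set (X → ℝ),
      (∀ n : ℕ, U n ⊆ Y) ∧
      -- each U n is open in (Y, ρ_Y)
      (∀ n : ℕ, ∀ g ∈ U n, ∃ ε : ℝ, 0 < ε ∧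
        ∀ h ∈ Y, muBP (g - h) < ENNReal.ofReal ε → h ∈ U n) ∧
      -- each U n is dense in (Y, ρ_Y)
      (∀ n : ℕ, ∀ g ∈ Y, ∀ ε : ℝ, 0 < ε → ∃ h ∈ U n, muBP (g - h) < ENNReal.ofReal ε) ∧
      -- every element of the intersection gives a strong minimum
      (∀ g ∈ ⋂ n, U n, ∃ x₀ : X, AttainsStrongMin (fun x => f x + (g x : EReal)) x₀) := by
  subst hY
  obtain ⟨b, hb⟩ := hbdd
  have hcases : ∀ x, f x = ⊤ ∨ ∃ r : ℝ, f x = r ∧ b ≤ r := fun x => by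
    by_cases h : f x = ⊤
    · exact Or.inl h
    · have e := EReal.coe_toReal h (hbot x)
      exact Or.inr ⟨(f x).toReal, e.symm, by have := hb x; rw [← e] at this; exact_mod_cast this⟩
  have hcoercive : ∀ {g : X → ℝ}, Tendsto g (comap (fun x : X => ‖x‖) atTop) atTop →
      ∀ M : ℝ, ∃ R : ℝ, ∀ x, R ≤ ‖x‖ → M ≤ g x := fun {g} hg M => by
    obtain ⟨t, ht, hsub⟩ := mem_comap.1 (hg.eventually_ge_atTop M)
    obtain ⟨R, hR⟩ := mem_atTop_sets.1 ht
    exact ⟨R, fun x hx => hsub (hR _ hx)⟩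
  refine ⟨fun n => {g | (ContDiff ℝ 1 g ∧ ConvexOn ℝ univ g ∧ (∀ x, 0 ≤ g x) ∧
      Tendsto g (comap (fun x : X => ‖x‖) atTop) atTop ∧ muBP g < ⊤) ∧
      ∃ (a : X) (c : ℝ), f a + (g a : EReal) < c ∧
        ∀ x, 1 / ((n : ℝ) + 1) ≤ ‖x - a‖ → (c : EReal) ≤ f x + (g x : EReal)},
    fun n g hg => hg.1, ?_, ?_, ?_⟩
  · rintro n g ⟨⟨-, -, -, hginf, -⟩, a, c, hac, hc⟩
    obtain hfa | ⟨r, hfa, hbr⟩ := hcases a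
    · simp [hfa] at hac
    rw [hfa] at hac
    have hac' : r + g a < c := by exact_mod_cast hac
    set η := (c - (r + g a)) / 3 with hη
    have hη0 : 0 < η := by rw [hη]; linarith
    obtain ⟨R, hR⟩ := hcoercive hginf (max (c - b) (g 0 + 2 * η))
    obtain ⟨N, hN⟩ := exists_nat_ge (max R ‖a‖)
    have hRN : R ≤ N + 1 := by linarith [le_max_left R ‖a‖]
    have haN : ‖a‖ ≤ N + 1 := by linarith [le_max_right R ‖a‖]
    refine ⟨η / 2 ^ (N + 1), by positivity, fun h hh hgh => ⟨hh, a, c - η, ?_, fun x hx => ?_⟩⟩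
    · rw [hfa]
      have := (abs_lt.1 (abs_lt_of_muBP_lt hgh haN)).1
      rw [Pi.sub_apply] at this
      have : r + h a < c - η := by linarith
      exact_mod_cast this
    · obtain hfx | ⟨s, hfx, hbs⟩ := hcases x
      · simp [hfx]
      have hcx := hc x hx
      rw [hfx] at hcx ⊢
      have hcx' : c ≤ s + g x := by exact_mod_cast hcx
      suffices c - η ≤ s + h x by exact_mod_cast this
      rcases le_total ‖x‖ (N + 1) with hxN | hxN
      · have := (abs_lt.1 (abs_lt_of_muBP_lt hgh hxN)).2
        rw [Pi.sub_apply] at this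
        linarith
      · have h0 := (abs_lt.1 (abs_lt_of_muBP_lt hgh (x := 0) (by simp; positivity))).1
        rw [Pi.sub_apply] at h0
        have := hh.2.1.le_of_le_on_sphere (R := N + 1)
          (c := max (c - b) (g 0 + 2 * η) - η) (by positivity)
          (by linarith [le_max_right (c - b) (g 0 + 2 * η)])
          (fun y hy => by
            have h1 := (abs_lt.1 (abs_lt_of_muBP_lt hgh hy.le)).2
            rw [Pi.sub_apply] at h1
            linarith [hR y (hy ▸ hRN)]) hxN
        linarith [le_max_left (c - b) (g 0 + 2 * η)]
  · rintro n g ⟨hg1, hgc, hg0, hginf, hgmu⟩ ε hε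
    obtain ⟨m, hm, hmin⟩ := exists_real_isGLB (h := fun x => f x + (g x : EReal)) (b := b)
      (fun x => (hb x).trans (le_add_of_nonneg_right (by exact_mod_cast hg0 x)))
      (hproper.imp fun x hx => EReal.add_ne_top hx (EReal.coe_ne_top _))
    obtain ⟨R, hR⟩ := hcoercive hginf (m + 1 - b)
    obtain ⟨K, hK, hKle⟩ := exists_muBP_norm_sub_sq_le (X := X) R
    set l := ε / (2 * K) with hl
    have hl0 : 0 < l := by positivity
    set d := min 1 (l * (1 / ((n : ℝ) + 1)) ^ 2) with hd
    have hd0 : 0 < d := by positivity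
    obtain ⟨a, ha⟩ := hmin d hd0
    obtain hfa | ⟨r, hfa, hbr⟩ := hcases a
    · simp [hfa] at ha
    have ha' : r + g a < m + d := by
      simp only [hfa] at ha
      exact_mod_cast ha
    have haR : ‖a‖ ≤ R := by
      by_contra! hlt
      linarith [hR a hlt.le, min_le_left 1 (l * (1 / ((n : ℝ) + 1)) ^ 2)]
    have hqd : Differentiable ℝ (fun x : X => l * ‖x - a‖ ^ 2) :=
      (differentiable_norm_sub_sq hsmooth a).const_mul l
    have hqc : ConvexOn ℝ univ (fun x : X => l * ‖x - a‖ ^ 2) :=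
      (convexOn_norm_sub_sq a).smul hl0.le
    have hq0 : ∀ x, 0 ≤ l * ‖x - a‖ ^ 2 := fun x => by positivity
    refine ⟨g + fun x => l * ‖x - a‖ ^ 2, ⟨⟨hg1.add (hqc.contDiff_one hqd), hgc.add hqc,
      fun x => add_nonneg (hg0 x) (hq0 x),
      tendsto_atTop_mono (fun x => le_add_of_nonneg_right (hq0 x)) hginf,
      (muBP_add_le (hg1.differentiable one_ne_zero) hqd).trans_lt
        (ENNReal.add_lt_top.2 ⟨hgmu, (hKle l a haR).trans_lt ENNReal.ofReal_lt_top⟩)⟩,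
      a, m + d, ?_, fun x hx => ?_⟩, ?_⟩
    · simpa using ha
    · obtain hfx | ⟨s, hfx, hbs⟩ := hcases x
      · rw [hfx, EReal.top_add_coe]
        exact le_top
      have hmx := hm x
      simp only [hfx] at hmx ⊢
      have hmx' : m ≤ s + g x := by exact_mod_cast hmx
      suffices m + d ≤ s + (g x + l * ‖x - a‖ ^ 2) by exact_mod_cast this
      have : l * (1 / ((n : ℝ) + 1)) ^ 2 ≤ l * ‖x - a‖ ^ 2 := by gcongr
      linarith [min_le_right 1 (l * (1 / ((n : ℝ) + 1)) ^ 2)]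
    · have e : g - (g + fun x => l * ‖x - a‖ ^ 2) = fun x => -l * ‖x - a‖ ^ 2 := by
        ext x; simp
      rw [e]
      refine (hKle (-l) a haR).trans_lt ((ENNReal.ofReal_lt_ofReal_iff hε).2 ?_)
      rw [abs_neg, abs_of_pos hl0, hl]
      field_simp
      norm_num
  · intro g hg
    rw [mem_iInter] at hg
    refine exists_attainsStrongMin (hlsc.add' ?_ fun x => ?_) fun n => ?_
    · exact (continuous_coe_real_ereal.comp (hg 0).1.1.continuous).lowerSemicontinuous
    · exact EReal.continuousAt_add (Or.inr (EReal.coe_ne_bot _)) (Or.inr (EReal.coe_ne_top _))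
    · obtain ⟨-, a, c, hac, hc⟩ := hg n
      exact ⟨a, c, hac, hc⟩
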